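/- For every infinite cardinal λ and every positive integer n, the relation (λ^{+n}, n, λ) → n+2 holds: every map F from n-element subsets of λ^{+n} to subsets of λ^{+n} of cardinality less than λ admits a free set of size n+2. -/

import Mathlib

open scoped Cardinal

/-- Coordinates `i` of elements of `F s`, for `n`-element sets `s` inside the box `B`. -/
def BadSet {α : Type} {n : ℕ} (F : Finset α → Set α) (e : α ≃ (Fin (n + 1) → α))
    (i : Fin (n + 1)) (B : Fin (n + 1) → Set α) : Set α :=
  {x | ∃ s : Finset α, s.card = n ∧ (∀ a ∈ s, ∀ m, e a m ∈ B m) ∧ ∃ b ∈ F s, e b i = x}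

/-- The box at stage `l`. -/
def StageBox {α : Type} {n : ℕ} (A : Fin (n + 1) → Set α) (x : Fin (n + 1) → Fin 3 → α)
    (l : Fin (n + 1)) (E : Set α) : Fin (n + 1) → Set α :=
  fun m => if m < l then A m else if m = l then E else Set.range (x m)

/-- The requirement on the three points of coordinate `l`. -/
def GoodAt {α : Type} {n : ℕ} (F : Finset α → Set α) (e : α ≃ (Fin (n + 1) → α))
    (A : Fin (n + 1) → Set α) (x : Fin (n + 1) → Fin 3 → α) (l : Fin (n + 1)) : Prop :=
  (∀ k, x l k ∈ A l) ∧ x l 1 ∉ BadSet F e l (StageBox A x l {x l 0}) ∧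
    x l 2 ∉ BadSet F e l (StageBox A x l {x l 0, x l 1}) ∧
    x l 0 ≠ x l 1 ∧ x l 0 ≠ x l 2 ∧ x l 1 ≠ x l 2

theorem badSet_subset {α : Type} {n : ℕ} (F : Finset α → Set α) (e : α ≃ (Fin (n + 1) → α))
    (i : Fin (n + 1)) (B : Fin (n + 1) → Set α) :
    BadSet F e i B ⊆ ⋃ s ∈ {s : Finset α | s.card = n ∧ (∀ a ∈ s, ∀ m, e a m ∈ B m)},
      (fun b => e b i) '' F s := by
  rintro x ⟨s, h1, h2, b, hb, rfl⟩
  simp only [Set.mem_iUnion]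
  exact ⟨s, ⟨h1, h2⟩, b, hb, rfl⟩

theorem badSet_lt_of_finite {α : Type} {n : ℕ} (lam : Cardinal) (hlam : Cardinal.aleph0 ≤ lam)
    (F : Finset α → Set α) (hF : ∀ s : Finset α, s.card = n → #(F s) < lam)
    (e : α ≃ (Fin (n + 1) → α))
    (i : Fin (n + 1)) (B : Fin (n + 1) → Set α) (hB : ∀ m, (B m).Finite) :
    #(BadSet F e i B) < lam := by
  refine (Cardinal.mk_le_mk_of_subset (badSet_subset F e i B)).trans_lt ?_
  have hbox : {a | ∀ m, e a m ∈ B m}.Finite := by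
    have := (Set.Finite.pi' hB).preimage (f := e) e.injective.injOn
    exact this
  have hfin : {s : Finset α | s.card = n ∧ (∀ a ∈ s, ∀ m, e a m ∈ B m)}.Finite := by
    refine (hbox.toFinset.powerset.finite_toSet).subset ?_
    rintro s ⟨-, h⟩
    simp only [Finset.coe_powerset, Set.mem_preimage, Set.mem_powerset_iff]
    intro a ha
    simpa using h a ha
  have key : ∀ T : Set (Finset α), T.Finite → (∀ s ∈ T, s.card = n) →
      #(⋃ s ∈ T, (fun b => e b i) '' F s : Set α) < lam := by
    intro T hT
    induction T, hT using Set.Finite.induction_on with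
    | empty => intro _; simpa using lt_of_lt_of_le Cardinal.aleph0_pos hlam
    | insert _ _ ih =>
      intro h
      rw [Set.biUnion_insert]
      refine (Cardinal.mk_union_le _ _).trans_lt (Cardinal.add_lt_of_lt hlam ?_ ?_)
      · exact Cardinal.mk_image_le.trans_lt (hF _ (h _ (Set.mem_insert _ _)))
      · exact ih fun s hs => h s (Set.mem_insert_of_mem _ hs)
  exact key _ hfin fun s hs => hs.1

theorem badSet_le {α : Type} {n : ℕ} (lam μ : Cardinal) (hlam : Cardinal.aleph0 ≤ lam)
    (hμ : lam ≤ μ)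
    (F : Finset α → Set α) (hF : ∀ s : Finset α, s.card = n → #(F s) < lam)
    (e : α ≃ (Fin (n + 1) → α))
    (i : Fin (n + 1)) (B : Fin (n + 1) → Set α) (hB : ∀ m, #(B m) ≤ μ) :
    #(BadSet F e i B) ≤ μ := by
  have hμ0 := hlam.trans hμ
  refine (Cardinal.mk_le_mk_of_subset (badSet_subset F e i B)).trans ?_
  have hbox : #{a | ∀ m, e a m ∈ B m} ≤ μ := by
    have h1 : #{a | ∀ m, e a m ∈ B m} ≤ #((m : Fin (n + 1)) → B m) := by
      refine Cardinal.mk_le_of_injective (f := fun a m => ⟨e a.1 m, a.2 m⟩) ?_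
      intro a b hab
      apply Subtype.ext
      apply e.injective
      funext m
      have := congrFun hab m
      simpa using this
    refine h1.trans ?_
    rw [Cardinal.mk_pi]
    refine (Cardinal.prod_le_prod _ (fun _ => μ) hB).trans ?_
    rw [Cardinal.prod_const]
    simp only [Cardinal.mk_fin, Cardinal.lift_id]
    rw [Cardinal.power_natCast]
    exact Cardinal.power_nat_le hμ0
  have hfin : #{s : Finset α | s.card = n ∧ (∀ a ∈ s, ∀ m, e a m ∈ B m)} ≤ μ := by
    have h1 : #{s : Finset α | s.card = n ∧ (∀ a ∈ s, ∀ m, e a m ∈ B m)} ≤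
        #(Finset {a | ∀ m, e a m ∈ B m}) := by
      classical
      refine Cardinal.mk_le_of_injective (f := fun s => s.1.subtype _) ?_
      intro a b hab
      apply Subtype.ext
      ext z
      have hz := fun h => Finset.ext_iff.1 hab ⟨z, h⟩
      simp only [Finset.mem_subtype] at hz
      constructor
      · intro h; exact (hz (a.2.2 z h)).1 h
      · intro h; exact (hz (b.2.2 z h)).2 h
    refine h1.trans ?_
    rcases finite_or_infinite {a | ∀ m, e a m ∈ B m} with h | h
    · exact (Cardinal.lt_aleph0_of_finite _).le.trans hμ0
    · rw [Cardinal.mk_finset_of_infinite]; exact hbox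
  refine (Cardinal.mk_biUnion_le _ _).trans ?_
  refine (mul_le_mul' hfin (ciSup_le' fun s => ?_)).trans (Cardinal.mul_eq_self hμ0).le
  exact Cardinal.mk_image_le.trans ((hF _ s.2.1).le.trans hμ)

theorem succ_iter_ge (lam : Cardinal) (i : ℕ) : lam ≤ (Order.succ)^[i] lam := by
  induction i with
  | zero => exact le_rfl
  | succ k ih => rw [Function.iterate_succ_apply']; exact ih.trans (Order.le_succ _)

theorem succ_iter_mono (lam : Cardinal) : Monotone fun i => (Order.succ)^[i] lam := by
  apply monotone_nat_of_le_succ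
  intro k
  simp only [Function.iterate_succ_apply']
  exact Order.le_succ _

theorem badSet_lt {α : Type} {n : ℕ} (lam : Cardinal) (hlam : Cardinal.aleph0 ≤ lam)
    (F : Finset α → Set α) (hF : ∀ s : Finset α, s.card = n → #(F s) < lam)
    (e : α ≃ (Fin (n + 1) → α)) (A : Fin (n + 1) → Set α)
    (hA : ∀ i : Fin (n + 1), #(A i) = (Order.succ)^[i.val] lam)
    (x : Fin (n + 1) → Fin 3 → α)
    (i : Fin (n + 1)) (E : Set α) (hE : E.Finite) :
    #(BadSet F e i (StageBox A x i E)) < (Order.succ)^[i.val] lam := by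
  rcases hi : i.val with _ | j
  · apply badSet_lt_of_finite lam hlam F hF
    intro m
    unfold StageBox
    split_ifs with h1 h2
    · exact absurd h1 (by simp [Fin.lt_def, hi])
    · exact hE
    · exact Set.finite_range _
  · rw [Function.iterate_succ_apply', Order.lt_succ_iff]
    have hj := succ_iter_ge lam j
    apply badSet_le lam _ hlam hj F hF
    intro m
    unfold StageBox
    split_ifs with h1 h2
    · rw [hA]
      apply succ_iter_mono
      rw [Fin.lt_def] at h1
      omega
    · exact hE.lt_aleph0.le.trans (hlam.trans hj)
    · exact (Set.finite_range _).lt_aleph0.le.trans (hlam.trans hj)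

theorem exists_avoid {α : Type} (A X E : Set α) (hA : Cardinal.aleph0 ≤ #A) (hX : #X < #A)
    (hE : E.Finite) : ∃ a ∈ A, a ∉ X ∧ a ∉ E := by
  by_contra! h
  have hsub : A ⊆ X ∪ E := by
    intro a ha
    by_cases hx : a ∈ X
    · exact Or.inl hx
    · exact Or.inr (h a ha hx)
  have := (Cardinal.mk_le_mk_of_subset hsub).trans (Cardinal.mk_union_le _ _)
  exact absurd this (not_le.2 (Cardinal.add_lt_of_lt hA hX (hE.lt_aleph0.trans_le hA)))

theorem stageBox_congr {α : Type} {n : ℕ} (A : Fin (n + 1) → Set α)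
    (x x' : Fin (n + 1) → Fin 3 → α) (l : Fin (n + 1)) (E : Set α)
    (h : ∀ m, l < m → x m = x' m) : StageBox A x l E = StageBox A x' l E := by
  funext m
  unfold StageBox
  split_ifs with h1 h2
  · rfl
  · rfl
  · rw [h m (lt_of_le_of_ne (not_lt.1 h1) (Ne.symm h2))]

theorem exists_good {α : Type} {n : ℕ} (lam : Cardinal) (hlam : Cardinal.aleph0 ≤ lam)
    (F : Finset α → Set α) (hF : ∀ s : Finset α, s.card = n → #(F s) < lam)
    (e : α ≃ (Fin (n + 1) → α)) (A : Fin (n + 1) → Set α)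
    (hA : ∀ i : Fin (n + 1), #(A i) = (Order.succ)^[i.val] lam) [Nonempty α] (d : ℕ) :
    ∃ x : Fin (n + 1) → Fin 3 → α, ∀ l : Fin (n + 1), n + 1 ≤ l.val + d → GoodAt F e A x l := by
  classical
  induction d with
  | zero =>
    refine ⟨fun _ _ => Classical.arbitrary α, fun l hl => ?_⟩
    have := l.isLt
    omega
  | succ d ih =>
    obtain ⟨x, hx⟩ := ih
    by_cases hd : n < d
    · exact ⟨x, fun l _ => hx l (by omega)⟩
    let l : Fin (n + 1) := ⟨n - d, by omega⟩
    have hinf : Cardinal.aleph0 ≤ #(A l) := by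
      rw [hA]; exact hlam.trans (succ_iter_ge _ _)
    have hb : ∀ E : Set α, E.Finite → #(BadSet F e l (StageBox A x l E)) < #(A l) := by
      intro E hE
      rw [hA]
      exact badSet_lt lam hlam F hF e A hA x l E hE
    obtain ⟨a, ha, -, -⟩ := exists_avoid (A l) _ ∅ hinf (hb ∅ Set.finite_empty) Set.finite_empty
    obtain ⟨b, hbA, hb1, hb2⟩ := exists_avoid (A l) _ {a} hinf (hb {a} (Set.toFinite _))
      (Set.toFinite _)
    obtain ⟨c, hcA, hc1, hc2⟩ := exists_avoid (A l) _ {a, b} hinf (hb {a, b} (Set.toFinite _))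
      (Set.toFinite _)
    simp only [Set.mem_singleton_iff, Set.mem_insert_iff, not_or] at hb2 hc2
    have hcongr : ∀ (l' : Fin (n + 1)) (E : Set α), l ≤ l' →
        StageBox A (Function.update x l ![a, b, c]) l' E = StageBox A x l' E := by
      intro l' E hl'
      apply stageBox_congr
      intro m hm
      rw [Function.update_of_ne (lt_of_le_of_lt hl' hm).ne']
    refine ⟨Function.update x l ![a, b, c], fun l' hl' => ?_⟩
    have hle : l ≤ l' := by
      rw [Fin.le_def]; simp only [l]; omega
    unfold GoodAt
    rw [hcongr _ _ hle, hcongr _ _ hle]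
    by_cases heq : l' = l
    · rw [heq]
      simp only [Function.update_self]
      refine ⟨?_, hb1, hc1, Ne.symm hb2, Ne.symm hc2.1, Ne.symm hc2.2⟩
      intro k
      fin_cases k
      · exact ha
      · exact hbA
      · exact hcA
    · rw [Function.update_of_ne heq]
      apply hx l'
      have : l.val ≠ l'.val := fun h => heq (Fin.ext h.symm)
      rw [Fin.le_def] at hle
      simp only [l] at this hle
      omega

/-- For every infinite cardinal `λ` and positive integer `n`, the relation
`(λ^{+n}, n, λ) → n+2` holds: every map from `n`-element subsets of a set of size `λ^{+n}`
to subsets of size `< λ` admits a free set of size `n+2`. -/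
theorem stmt_3 (lam : Cardinal) (hlam : Cardinal.aleph0 ≤ lam) (n : ℕ) (hn : 0 < n)
    (α : Type) [DecidableEq α] (hα : #α = (Order.succ)^[n] lam) (F : Finset α → Set α)
    (hF : ∀ s : Finset α, s.card = n → #(F s) < lam) :
    ∃ H : Finset α, H.card = n + 2 ∧
      ∀ a ∈ H, ∀ s ⊆ H.erase a, s.card = n → a ∉ F s := by
  have hαinf : Cardinal.aleph0 ≤ #α := by rw [hα]; exact hlam.trans (succ_iter_ge _ _)
  have : Infinite α := Cardinal.infinite_iff.2 hαinf
  have hcard : #α = #(Fin (n + 1) → α) := by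
    rw [← Cardinal.power_def, Cardinal.mk_fin, Cardinal.power_natCast,
      Cardinal.power_nat_eq hαinf (by omega)]
  obtain ⟨e⟩ := Cardinal.eq.1 hcard
  have hex : ∀ i : Fin (n + 1), ∃ A : Set α, #A = (Order.succ)^[i.val] lam := by
    intro i
    rw [← Cardinal.le_mk_iff_exists_set, hα]
    exact succ_iter_mono lam (by have := i.isLt; omega)
  choose A hA using hex
  obtain ⟨x, hx⟩ := exists_good lam hlam F hF e A hA (n + 1)
  replace hx : ∀ l, GoodAt F e A x l := fun l => hx l (by omega)
  let z : Option (Fin (n + 1)) → Fin (n + 1) → Fin 3 := fun o m =>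
    match o with
    | none => 1
    | some a => if m = a then 2 else 0
  let y : Option (Fin (n + 1)) → α := fun o => e.symm fun m => x m (z o m)
  have hey : ∀ o m, e (y o) m = x m (z o m) := fun o m => by simp [y]
  have hxinj : ∀ l, Function.Injective (x l) := by
    intro l i j hij
    obtain ⟨-, -, -, h1, h2, h3⟩ := hx l
    fin_cases i <;> fin_cases j
    · rfl
    · exact absurd hij h1
    · exact absurd hij h2
    · exact absurd hij.symm h1
    · rfl
    · exact absurd hij h3
    · exact absurd hij.symm h2
    · exact absurd hij.symm h3
    · rfl
  have hyinj : Function.Injective y := by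
    intro o o' h
    have hz : ∀ m, z o m = z o' m := by
      intro m
      apply hxinj m
      rw [← hey, ← hey, h]
    rcases o with _ | a <;> rcases o' with _ | b
    · rfl
    · have := hz b
      simp [z] at this
    · have := hz a
      simp [z] at this
    · have := hz a
      by_cases hab : a = b
      · rw [hab]
      · simp [z, hab] at this
  refine ⟨Finset.univ.image y, ?_, ?_⟩
  · rw [Finset.card_image_of_injective _ hyinj]
    simp
  intro a ha s hs hsc haF
  obtain ⟨o, -, rfl⟩ := Finset.mem_image.1 ha
  have hmem : ∀ b ∈ s, ∃ o', o' ≠ o ∧ y o' = b := by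
    intro b hb
    have := hs hb
    rw [Finset.mem_erase, Finset.mem_image] at this
    obtain ⟨h1, o', -, rfl⟩ := this
    exact ⟨o', fun h => h1 (by rw [h]), rfl⟩
  have hbox : ∀ (l : Fin (n + 1)) (E : Set α), (∀ o', y o' ∈ s → x l (z o' l) ∈ E) →
      ∀ b ∈ s, ∀ m, e b m ∈ StageBox A x l E m := by
    intro l E hE b hb m
    obtain ⟨o', -, rfl⟩ := hmem b hb
    rw [hey]
    unfold StageBox
    split_ifs with h1 h2
    · exact (hx m).1 _
    · subst h2; exact hE o' hb
    · exact Set.mem_range_self _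
  rcases o with _ | i
  · have hb : ∃ b, y (some b) ∉ s := by
      by_contra! hall
      have hsub : (Finset.univ.image fun b : Fin (n + 1) => y (some b)) ⊆ s := by
        intro c hc
        obtain ⟨b, -, rfl⟩ := Finset.mem_image.1 hc
        exact hall b
      have := Finset.card_le_card hsub
      have hinj : Function.Injective fun b : Fin (n + 1) => y (some b) :=
        hyinj.comp (Option.some_injective _)
      rw [Finset.card_image_of_injective _ hinj] at this
      simp at this
      omega
    obtain ⟨b, hb⟩ := hb
    refine (hx b).2.1 ⟨s, hsc, hbox b _ ?_, y none, haF, hey none b⟩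
    intro o' ho'
    obtain ⟨o'', hne, heq⟩ := hmem _ ho'
    rw [hyinj heq] at hne
    rcases o' with _ | c
    · exact absurd rfl hne
    · have : b ≠ c := by rintro rfl; exact hb ho'
      simp [z, this]
  · refine (hx i).2.2.1 ⟨s, hsc, hbox i _ ?_, y (some i), haF, ?_⟩
    · intro o' ho'
      obtain ⟨o'', hne, heq⟩ := hmem _ ho'
      rw [hyinj heq] at hne
      rcases o' with _ | c
      · simp [z]
      · have : i ≠ c := by rintro rfl; exact hne rfl
        simp [z, this]
    · refine (hey (some i) i).trans ?_
      simp [z]
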